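/- (Centrality of the quantum determinant, the 2×2 single-series instance of Theorem 4.5) Under the RTT hypothesis, the quantum determinant qdet L(u) := l₁₁(u)·l₂₂(u+h) − l₂₁(u)·l₁₂(u+h) commutes with all generating series: qdet L(u)·l_{ij}(v) = l_{ij}(v)·qdet L(u) in A[[u^{-1}, v^{-1}]] for all 1 ≤ i, j ≤ 2. -/

import Mathlib

noncomputable section

variable {A : Type*} [Ring A]

/-- A power series in `u⁻¹` (given by its coefficients) viewed as a Hahn series over `ℤ`,
the exponent being the power of `u⁻¹`. -/
def ofSeq (a : ℕ → A) : HahnSeries ℤ A :=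
  HahnSeries.ofPowerSeries ℤ A (PowerSeries.mk a)

/-- The ambient ring containing `A[[u⁻¹, v⁻¹]][u, v]`: iterated Hahn series over `ℤ`
(inner exponent = power of `u⁻¹`, outer exponent = power of `v⁻¹`). -/
abbrev TT (A : Type*) [Ring A] := HahnSeries ℤ (HahnSeries ℤ A)

/-- A power series in `u⁻¹` inside the two-variable ring. -/
def inU (a : ℕ → A) : TT A := HahnSeries.single (0 : ℤ) (ofSeq a)

/-- A power series in `v⁻¹` inside the two-variable ring. -/
def inV (a : ℕ → A) : TT A := ofSeq (fun m => HahnSeries.single (0 : ℤ) (a m))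

/-- A scalar of `A` inside the two-variable ring. -/
def sc (a : A) : TT A := HahnSeries.single (0 : ℤ) (HahnSeries.single (0 : ℤ) a)

/-- The element `u`. -/
def Uv (A : Type*) [Ring A] : TT A := HahnSeries.single (0 : ℤ) (HahnSeries.single (-1 : ℤ) 1)

/-- The element `v`. -/
def Vv (A : Type*) [Ring A] : TT A := HahnSeries.single (-1 : ℤ) 1

/-- The coefficient sequence of `l_{ij}(u) = δ_{ij} − h·Σ_{r≥0} l_{ij}^{(r)} u^{−r−1}`,
built from the generators `lgen i j r = l_{ij}^{(r)}`. -/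
def lcoef {N : ℕ} (h : A) (lgen : Fin N → Fin N → ℕ → A) (i j : Fin N) : ℕ → A :=
  fun r => if r = 0 then (if i = j then 1 else 0) else -(h * lgen i j (r - 1))

/-- The RTT relation for Yang's R-matrix, with denominators cleared:
`(u−v)(l_{ij}(u)l_{kl}(v) − l_{kl}(v)l_{ij}(u)) = h(l_{kj}(v)l_{il}(u) − l_{kj}(u)l_{il}(v))`. -/
def RTT {N : ℕ} (h : A) (lgen : Fin N → Fin N → ℕ → A) : Prop :=
  ∀ i j k l : Fin N,
    (Uv A - Vv A) *
        (inU (lcoef h lgen i j) * inV (lcoef h lgen k l) -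
          inV (lcoef h lgen k l) * inU (lcoef h lgen i j)) =
      sc h *
        (inV (lcoef h lgen k j) * inU (lcoef h lgen i l) -
          inU (lcoef h lgen k j) * inV (lcoef h lgen i l))

/-- `k₁(u) = l₁₁(u)` as a series in `u`. -/
def k1U (h : A) (lgen : Fin 2 → Fin 2 → ℕ → A) : TT A := inU (lcoef h lgen 0 0)

/-- `k₁(v)` as a series in `v`. -/
def k1V (h : A) (lgen : Fin 2 → Fin 2 → ℕ → A) : TT A := inV (lcoef h lgen 0 0)

/-- `e(u) = k₁(u)⁻¹·l₁₂(u)`, given the inverse `k1uinv` of `k₁(u)`. -/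
def eU (h : A) (lgen : Fin 2 → Fin 2 → ℕ → A) (k1uinv : TT A) : TT A :=
  k1uinv * inU (lcoef h lgen 0 1)

def eV (h : A) (lgen : Fin 2 → Fin 2 → ℕ → A) (k1vinv : TT A) : TT A :=
  k1vinv * inV (lcoef h lgen 0 1)

/-- `f(u) = l₂₁(u)·k₁(u)⁻¹`. -/
def fU (h : A) (lgen : Fin 2 → Fin 2 → ℕ → A) (k1uinv : TT A) : TT A :=
  inU (lcoef h lgen 1 0) * k1uinv

def fV (h : A) (lgen : Fin 2 → Fin 2 → ℕ → A) (k1vinv : TT A) : TT A :=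
  inV (lcoef h lgen 1 0) * k1vinv

/-- `k₂(u) = l₂₂(u) − f(u)·k₁(u)·e(u)`. -/
def k2U (h : A) (lgen : Fin 2 → Fin 2 → ℕ → A) (k1uinv : TT A) : TT A :=
  inU (lcoef h lgen 1 1) - fU h lgen k1uinv * k1U h lgen * eU h lgen k1uinv

def k2V (h : A) (lgen : Fin 2 → Fin 2 → ℕ → A) (k1vinv : TT A) : TT A :=
  inV (lcoef h lgen 1 1) - fV h lgen k1vinv * k1V h lgen * eV h lgen k1vinv

/-- The coefficients of the substituted series `g(u+h)`: each `u^{-m}` is replaced by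
`(u+h)^{-m} = u^{-m}(1 + h·u⁻¹)^{-m}`, whose coefficient of `u^{-N}` is
`(-h)^{N-m}·C(N-1, N-m)`. -/
def shiftSeq (h : A) (a : ℕ → A) : ℕ → A :=
  fun N => ∑ m ∈ Finset.range (N + 1),
    a m * ((-h) ^ (N - m) * ((N - 1).choose (N - m) : A))

/-- The quantum determinant `qdet L(u) = l₁₁(u)·l₂₂(u+h) − l₂₁(u)·l₁₂(u+h)`,
as a series in `u`. -/
def qdetU (h : A) (lgen : Fin 2 → Fin 2 → ℕ → A) : TT A :=
  inU (lcoef h lgen 0 0) * inU (shiftSeq h (lcoef h lgen 1 1)) -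
    inU (lcoef h lgen 1 0) * inU (shiftSeq h (lcoef h lgen 0 1))

theorem shiftSeq_sub (h : A) (x y : ℕ → A) (n : ℕ) :
    shiftSeq h (fun m => x m - y m) n = shiftSeq h x n - shiftSeq h y n := by
  simp only [shiftSeq, sub_mul, Finset.sum_sub_distrib]

theorem shiftSeq_const_mul (h c : A) (x : ℕ → A) (n : ℕ) :
    shiftSeq h (fun m => c * x m) n = c * shiftSeq h x n := by
  simp only [shiftSeq, Finset.mul_sum, mul_assoc]

theorem shiftSeq_mul_const (h : A) (hcen : ∀ a : A, a * h = h * a) (c : A) (x : ℕ → A) (n : ℕ) :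
    shiftSeq h (fun m => x m * c) n = shiftSeq h x n * c := by
  simp only [shiftSeq, Finset.sum_mul]
  refine Finset.sum_congr rfl fun m _ => ?_
  have hc : Commute c ((-h) ^ (n - m) * (((n - 1).choose (n - m) : ℕ) : A)) :=
    ((show Commute c h from hcen c).neg_right.pow_right _).mul_right (Nat.cast_commute _ _).symm
  rw [mul_assoc, hc.eq, ← mul_assoc (x m)]

theorem shiftSeq_zero (h : A) (x : ℕ → A) : shiftSeq h x 0 = x 0 := by
  simp [shiftSeq]

/-- Multiplication of a series without constant term by `u` becomes multiplication by `u + h`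
after the substitution `u ↦ u + h`. -/
theorem shiftSeq_tail (h : A) (hcen : ∀ a : A, a * h = h * a) (x : ℕ → A) (hx : x 0 = 0) (n : ℕ) :
    shiftSeq h (fun m => x (m + 1)) n = shiftSeq h x (n + 1) + h * shiftSeq h x n := by
  cases n with
  | zero => simp [shiftSeq, Finset.sum_range_succ, hx]
  | succ n =>
    have h1 : shiftSeq h x (n + 1 + 1) = ∑ m ∈ Finset.range (n + 1 + 1),
        x (m + 1) * ((-h) ^ (n + 1 - m) * ((n + 1).choose (n + 1 - m) : A)) := by
      rw [shiftSeq, Finset.sum_range_succ']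
      simp [hx]
    have h2 : shiftSeq h x (n + 1) = ∑ m ∈ Finset.range (n + 1),
        x (m + 1) * ((-h) ^ (n - m) * (n.choose (n - m) : A)) := by
      rw [shiftSeq, Finset.sum_range_succ']
      simp [hx]
    rw [h1, h2, shiftSeq, Finset.sum_range_succ, Finset.sum_range_succ _ (n + 1),
      add_right_comm (Finset.sum _ _), Finset.mul_sum, ← Finset.sum_add_distrib]
    congr 1
    · refine Finset.sum_congr rfl fun m hm => ?_
      obtain ⟨j, rfl⟩ := Nat.exists_eq_add_of_le (Nat.lt_succ_iff.mp (Finset.mem_range.mp hm))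
      have e1 : m + j + 1 - m = j + 1 := by omega
      have e2 : m + j - m = j := by omega
      rw [e1, e2, Nat.add_sub_cancel, Nat.choose_succ_succ', ← mul_assoc h, ← hcen, mul_assoc,
        ← mul_add, Nat.cast_add, pow_succ', neg_mul, neg_mul, neg_mul, ← mul_assoc h]
      simp only [mul_add, mul_neg, neg_add]
      abel
    · simp

/-- The series `Σ_q f_q(u) v^{-q}`, specialised at `v = u + h`; the variable `X` stands
for `u⁻¹`. -/
def evalShift (h : A) (f : ℕ → PowerSeries A) : PowerSeries A :=
  PowerSeries.mk fun n => ∑ q ∈ Finset.range (n + 1),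
    PowerSeries.coeff (n - q) (shiftSeq (PowerSeries.C h) f q)

theorem powerSeries_C_central {h : A} (hcen : ∀ a : A, a * h = h * a) (f : PowerSeries A) :
    f * PowerSeries.C h = PowerSeries.C h * f := by
  ext n
  simp [hcen]

theorem evalShift_sub (h : A) (f g : ℕ → PowerSeries A) :
    evalShift h (fun s => f s - g s) = evalShift h f - evalShift h g := by
  ext n
  simp only [evalShift, shiftSeq_sub, map_sub, PowerSeries.coeff_mk, Finset.sum_sub_distrib]

theorem evalShift_const_mul (h c : A) (f : ℕ → PowerSeries A) :
    evalShift h (fun s => PowerSeries.C c * f s) = PowerSeries.C c * evalShift h f := by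
  ext n
  simp only [evalShift, shiftSeq_const_mul, PowerSeries.coeff_C_mul, PowerSeries.coeff_mk,
    Finset.mul_sum]

theorem shiftSeq_C (h : A) (c : ℕ → A) (n : ℕ) :
    shiftSeq (PowerSeries.C h) (fun s => PowerSeries.C (c s)) n
      = PowerSeries.C (shiftSeq h c n) := by
  simp [shiftSeq]

theorem evalShift_mul_C (h : A) (α : PowerSeries A) (c : ℕ → A) :
    evalShift h (fun s => α * PowerSeries.C (c s)) = α * PowerSeries.mk (shiftSeq h c) := by
  ext n
  simp only [evalShift, shiftSeq_const_mul, shiftSeq_C, PowerSeries.coeff_mul_C,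
    PowerSeries.coeff_mk]
  rw [PowerSeries.coeff_mul, ← Finset.Nat.sum_antidiagonal_swap,
    Finset.Nat.sum_antidiagonal_eq_sum_range_succ_mk]
  simp

theorem evalShift_C_mul (h : A) (hcen : ∀ a : A, a * h = h * a) (α : PowerSeries A) (c : ℕ → A) :
    evalShift h (fun s => PowerSeries.C (c s) * α) = PowerSeries.mk (shiftSeq h c) * α := by
  ext n
  simp only [evalShift, shiftSeq_mul_const _ (powerSeries_C_central hcen), shiftSeq_C,
    PowerSeries.coeff_C_mul, PowerSeries.coeff_mk]
  rw [PowerSeries.coeff_mul, Finset.Nat.sum_antidiagonal_eq_sum_range_succ_mk]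
  simp

/-- If `D(u, v)` has no constant term in `v⁻¹` and `(u - v) D(u, v) = g(u, v)`, then
`-h D(u, u + h) = g(u, u + h)`. -/
theorem evalShift_of_sub_mul (h : A) (hcen : ∀ a : A, a * h = h * a) (D g : ℕ → PowerSeries A)
    (h0 : D 0 = 0) (hD : ∀ s, PowerSeries.X * D (s + 1) = D s - PowerSeries.X * g s) :
    PowerSeries.C h * evalShift h D = - evalShift h g := by
  have hX (f : ℕ → PowerSeries A) :
      evalShift h (fun s => PowerSeries.X * f s) = PowerSeries.X * evalShift h f := by
    ext n
    cases n with
    | zero => simp [evalShift, shiftSeq_const_mul, PowerSeries.coeff_zero_X_mul]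
    | succ n =>
      rw [PowerSeries.coeff_succ_X_mul]
      simp only [evalShift, shiftSeq_const_mul, PowerSeries.coeff_mk]
      rw [Finset.sum_range_succ]
      simp only [Nat.sub_self, PowerSeries.coeff_zero_X_mul, add_zero]
      refine Finset.sum_congr rfl fun q hq => ?_
      rw [Nat.succ_sub (Nat.lt_succ_iff.mp (Finset.mem_range.mp hq)), PowerSeries.coeff_succ_X_mul]
  have htail : PowerSeries.X * evalShift h (fun s => D (s + 1)) =
      evalShift h D + PowerSeries.X * (PowerSeries.C h * evalShift h D) := by
    ext n
    cases n with
    | zero => simp [evalShift, shiftSeq_zero, h0, PowerSeries.coeff_zero_X_mul]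
    | succ n =>
      rw [map_add, PowerSeries.coeff_succ_X_mul, PowerSeries.coeff_succ_X_mul,
        PowerSeries.coeff_C_mul]
      simp only [evalShift, PowerSeries.coeff_mk,
        shiftSeq_tail _ (powerSeries_C_central hcen) D h0, map_add, PowerSeries.coeff_C_mul]
      rw [Finset.sum_add_distrib, Finset.sum_range_succ' _ (n + 1), Finset.mul_sum]
      simp [shiftSeq_zero, h0]
  have hcombine := hX (fun s => D (s + 1))
  simp only [hD] at hcombine
  rw [evalShift_sub, hX, htail, sub_eq_add_neg, add_right_inj, ← mul_neg] at hcombine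
  ext n
  have := congrArg (PowerSeries.coeff (n + 1)) hcombine
  rw [PowerSeries.coeff_succ_X_mul, PowerSeries.coeff_succ_X_mul] at this
  exact this.symm

/-- The coefficient of `v^{-s}` in the divided difference `(a(u) - a(v)) / (u - v)`. -/
def divDiff (a : ℕ → A) (s : ℕ) : PowerSeries A :=
  if s = 0 then 0 else PowerSeries.mk fun i => if i = 0 then 0 else -a (i + s - 1)

theorem X_mul_divDiff_succ (a : ℕ → A) (s : ℕ) :
    PowerSeries.X * divDiff a (s + 1) = divDiff a s -
      PowerSeries.X * ((if s = 0 then PowerSeries.mk a else 0) - PowerSeries.C (a s)) := by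
  ext n
  rcases n with _ | _ | n
  · rcases s with _ | s <;> simp [divDiff, PowerSeries.coeff_zero_X_mul]
  · rcases s with _ | s <;> simp [divDiff, PowerSeries.coeff_succ_X_mul, Nat.add_comm 1]
  · rcases s with _ | s <;>
    simp [divDiff, PowerSeries.coeff_succ_X_mul, PowerSeries.coeff_X, Nat.add_right_comm _ 1,
      ← Nat.add_assoc]

/-- The coefficient form of
`(u + k - v) (a(u) c(v) - c(v) a(u)) = h (p₂(v) q(u) - p(u) q₂(v))`. -/
structure CoeffRel (k h : A) (a c p q p₂ q₂ : ℕ → A) : Prop where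
  zero_left : ∀ s, a 0 * c s - c s * a 0 = 0
  zero_right : ∀ r, a r * c 0 - c 0 * a r = 0
  step : ∀ r s, (a (r + 1) * c s - c s * a (r + 1)) + k * (a r * c s - c s * a r) -
    (a r * c (s + 1) - c (s + 1) * a r) = h * (p₂ s * q r - p r * q₂ s)

/-- The substitution `u ↦ u + h` in the relation. -/
theorem CoeffRel.shift {h : A} (hcen : ∀ a : A, a * h = h * a) {a c p q p₂ q₂ : ℕ → A}
    (H : CoeffRel 0 h a c p q p₂ q₂) :
    CoeffRel h h (shiftSeq h a) c (shiftSeq h p) (shiftSeq h q) p₂ q₂ := by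
  have hcomm (s n : ℕ) : shiftSeq h (fun r => a r * c s - c s * a r) n =
      shiftSeq h a n * c s - c s * shiftSeq h a n := by
    rw [shiftSeq_sub, shiftSeq_mul_const h hcen, shiftSeq_const_mul]
  refine ⟨fun s => ?_, fun r => ?_, fun r s => ?_⟩
  · simpa only [shiftSeq_zero] using H.zero_left s
  · rw [← hcomm]
    simp [shiftSeq, H.zero_right]
  · rw [← hcomm, ← hcomm, ← hcomm, ← shiftSeq_tail h hcen _ (H.zero_left s), ← shiftSeq_sub,
      ← shiftSeq_const_mul, ← shiftSeq_mul_const h hcen, ← shiftSeq_sub, ← shiftSeq_const_mul]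
    congr 1
    funext n
    simpa using H.step n s

/-- Specialisation of the relation at `v = u + h`, with the factor `h` cancelled. -/
theorem CoeffRel.fusion {h : A} (hcen : ∀ a : A, a * h = h * a) {a c p q : ℕ → A}
    (H : CoeffRel 0 h a c p q p q) :
    PowerSeries.mk a * PowerSeries.mk (shiftSeq h c) -
      PowerSeries.mk (shiftSeq h c) * PowerSeries.mk a =
    PowerSeries.mk p * PowerSeries.mk (shiftSeq h q) -
      PowerSeries.mk (shiftSeq h p) * PowerSeries.mk q := by
  set D : ℕ → PowerSeries A := fun s =>
    PowerSeries.mk p * divDiff q s - divDiff p s * PowerSeries.mk q with hDdef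
  set g : ℕ → PowerSeries A := fun s =>
    PowerSeries.C (p s) * PowerSeries.mk q - PowerSeries.mk p * PowerSeries.C (q s) with hg
  have hXc (f : PowerSeries A) : PowerSeries.X * f = f * PowerSeries.X :=
    (PowerSeries.commute_X f).eq.symm
  have h0 : D 0 = 0 := by simp [hDdef, divDiff]
  have hD (s : ℕ) : PowerSeries.X * D (s + 1) = D s - PowerSeries.X * g s := by
    simp only [hDdef, hg]
    rw [mul_sub, ← mul_assoc, hXc, mul_assoc, ← mul_assoc _ (divDiff p _), X_mul_divDiff_succ,
      X_mul_divDiff_succ]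
    rw [mul_sub, ← mul_assoc _ PowerSeries.X, ← hXc, sub_mul]
    split_ifs <;> noncomm_ring
  have hX (s : ℕ) : PowerSeries.mk a * PowerSeries.C (c s) - PowerSeries.C (c s) * PowerSeries.mk a
      = PowerSeries.C h * D s := by
    induction s with
    | zero =>
      ext n
      simpa [h0] using H.zero_right n
    | succ s ih =>
      have key : PowerSeries.X * (PowerSeries.mk a * PowerSeries.C (c (s + 1)) -
          PowerSeries.C (c (s + 1)) * PowerSeries.mk a) =
          PowerSeries.X * (PowerSeries.C h * D (s + 1)) := by
        rw [← mul_assoc _ (PowerSeries.C h), hXc (PowerSeries.C h), mul_assoc, hD, mul_sub (PowerSeries.C h), ← ih,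
          ← mul_assoc _ PowerSeries.X, ← hXc, mul_assoc]
        ext n
        cases n with
        | zero => simpa [PowerSeries.coeff_zero_X_mul] using (H.zero_left s).symm
        | succ n =>
          have := H.step n s
          simp only [hg, PowerSeries.coeff_succ_X_mul, map_sub, PowerSeries.coeff_C_mul,
            PowerSeries.coeff_mul_C, PowerSeries.coeff_mk]
          rw [← this, zero_mul, add_zero]
          abel
      ext n
      have := congrArg (PowerSeries.coeff (n + 1)) key
      rwa [PowerSeries.coeff_succ_X_mul, PowerSeries.coeff_succ_X_mul] at this
  calc _ = evalShift h (fun s => PowerSeries.mk a * PowerSeries.C (c s) -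
        PowerSeries.C (c s) * PowerSeries.mk a) := by
        rw [evalShift_sub, evalShift_mul_C, evalShift_C_mul h hcen]
    _ = - evalShift h g := by
        simp only [hX]
        rw [evalShift_const_mul, evalShift_of_sub_mul h hcen D g h0 hD]
    _ = _ := by
        rw [hg, evalShift_sub, evalShift_mul_C, evalShift_C_mul h hcen, neg_sub]

theorem ofSeq_coeff_natCast (a : ℕ → A) (n : ℕ) : (ofSeq a).coeff (n : ℤ) = a n := by
  simp [ofSeq]

theorem ofSeq_coeff_of_neg (a : ℕ → A) {n : ℤ} (hn : n < 0) : (ofSeq a).coeff n = 0 := by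
  rw [ofSeq, HahnSeries.ofPowerSeries_apply]
  refine HahnSeries.embDomain_of_notMem_range ?_
  rintro ⟨m, rfl⟩
  exact absurd hn (by simp)

theorem inV_coeff (c : ℕ → A) (s : ℤ) :
    (inV c).coeff s = HahnSeries.single (0 : ℤ) ((ofSeq c).coeff s) := by
  rw [inV]
  rcases lt_or_ge s 0 with hs | hs
  · simp [ofSeq_coeff_of_neg _ hs]
  · lift s to ℕ using hs
    simp [ofSeq_coeff_natCast]

theorem inU_mul_inV_coeff (a c : ℕ → A) (s r : ℤ) :
    ((inU a * inV c).coeff s).coeff r = (ofSeq a).coeff r * (ofSeq c).coeff s := by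
  rw [inU, HahnSeries.coeff_single_zero_mul, inV_coeff, HahnSeries.coeff_mul_single_zero]

theorem inV_mul_inU_coeff (a c : ℕ → A) (s r : ℤ) :
    ((inV c * inU a).coeff s).coeff r = (ofSeq c).coeff s * (ofSeq a).coeff r := by
  rw [inU, HahnSeries.coeff_mul_single_zero, inV_coeff, HahnSeries.coeff_single_zero_mul]

theorem sc_mul_coeff (h : A) (y : TT A) (s r : ℤ) :
    ((sc h * y).coeff s).coeff r = h * (y.coeff s).coeff r := by
  rw [sc, HahnSeries.coeff_single_zero_mul, HahnSeries.coeff_single_zero_mul]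

theorem Uv_mul_coeff (y : TT A) (s r : ℤ) :
    ((Uv A * y).coeff s).coeff r = (y.coeff s).coeff (r + 1) := by
  rw [Uv, HahnSeries.coeff_single_zero_mul, HahnSeries.coeff_single_mul, one_mul, sub_neg_eq_add]

theorem Vv_mul_coeff (y : TT A) (s : ℤ) : (Vv A * y).coeff s = y.coeff (s + 1) := by
  rw [Vv, HahnSeries.coeff_single_mul, one_mul, sub_neg_eq_add]

theorem coeffRel_iff (k h : A) (a c p q p₂ q₂ : ℕ → A) :
    CoeffRel k h a c p q p₂ q₂ ↔
      (Uv A + sc k - Vv A) * (inU a * inV c - inV c * inU a) =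
        sc h * (inV p₂ * inU q - inU p * inV q₂) := by
  have hcoeff : (Uv A + sc k - Vv A) * (inU a * inV c - inV c * inU a) =
        sc h * (inV p₂ * inU q - inU p * inV q₂) ↔ ∀ s r : ℤ,
      ((ofSeq a).coeff (r + 1) * (ofSeq c).coeff s - (ofSeq c).coeff s * (ofSeq a).coeff (r + 1)) +
        k * ((ofSeq a).coeff r * (ofSeq c).coeff s - (ofSeq c).coeff s * (ofSeq a).coeff r) -
        ((ofSeq a).coeff r * (ofSeq c).coeff (s + 1) -
          (ofSeq c).coeff (s + 1) * (ofSeq a).coeff r) =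
      h * ((ofSeq p₂).coeff s * (ofSeq q).coeff r - (ofSeq p).coeff r * (ofSeq q₂).coeff s) := by
    simp only [HahnSeries.ext_iff, funext_iff]
    refine forall_congr' fun s => forall_congr' fun r => ?_
    simp only [sub_mul (Uv A + sc k), add_mul (Uv A), HahnSeries.coeff_sub, HahnSeries.coeff_add,
      Uv_mul_coeff, Vv_mul_coeff, sc_mul_coeff, inU_mul_inV_coeff, inV_mul_inU_coeff]
  rw [hcoeff]
  have hneg (x : ℕ → A) : (ofSeq x).coeff (-1) = 0 := ofSeq_coeff_of_neg x (by norm_num)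
  have hzero (x : ℕ → A) : (ofSeq x).coeff 0 = x 0 := ofSeq_coeff_natCast x 0
  have hsucc (x : ℕ → A) (n : ℕ) : (ofSeq x).coeff ((n : ℤ) + 1) = x (n + 1) :=
    ofSeq_coeff_natCast x (n + 1)
  constructor
  · intro H s r
    have hcases (n : ℤ) : n < -1 ∨ n = -1 ∨ ∃ m : ℕ, n = m := by
      rcases lt_or_ge n 0 with hn | hn
      · omega
      · exact .inr (.inr ⟨n.toNat, (Int.toNat_of_nonneg hn).symm⟩)
    have hlt (x : ℕ → A) {n : ℤ} (hn : n < -1) :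
        (ofSeq x).coeff n = 0 ∧ (ofSeq x).coeff (n + 1) = 0 :=
      ⟨ofSeq_coeff_of_neg x (by omega), ofSeq_coeff_of_neg x (by omega)⟩
    rcases hcases r with hr | rfl | ⟨r, rfl⟩
    · simp [hlt _ hr]
    · rcases lt_or_ge s 0 with hs | hs
      · simp [hneg, ofSeq_coeff_of_neg _ hs]
      · lift s to ℕ using hs
        simpa [hneg, hzero, ofSeq_coeff_natCast] using H.zero_left s
    · rcases hcases s with hs | rfl | ⟨s, rfl⟩
      · simp [hlt _ hs]
      · simpa [hneg, hzero, ofSeq_coeff_natCast] using congrArg Neg.neg (H.zero_right r)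
      · simpa only [hsucc, ofSeq_coeff_natCast] using H.step r s
  · intro H
    refine ⟨fun s => ?_, fun r => ?_, fun r s => ?_⟩
    · simpa [hneg, hzero, ofSeq_coeff_natCast] using H s (-1)
    · simpa [hneg, hzero, ofSeq_coeff_natCast] using congrArg Neg.neg (H (-1) r)
    · simpa only [hsucc, ofSeq_coeff_natCast] using H s r

theorem single_mem_center {R : Type*} [Ring R] (n : ℤ) {r : R} (hr : r ∈ Subring.center R) :
    HahnSeries.single n r ∈ Subring.center (HahnSeries ℤ R) := by
  rw [Subring.mem_center_iff] at hr ⊢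
  intro y
  ext m
  rw [HahnSeries.coeff_mul_single, HahnSeries.coeff_single_mul, hr]

theorem eq_zero_of_sub_Vv_mul (z : HahnSeries ℤ A) (y : TT A)
    (hy : (HahnSeries.single (0 : ℤ) z - Vv A) * y = 0) : y = 0 := by
  by_contra hne
  have hcoeff := congrArg (fun w => HahnSeries.coeff w (y.order - 1)) hy
  simp only [sub_mul, HahnSeries.coeff_sub, HahnSeries.coeff_single_zero_mul, Vv_mul_coeff,
    sub_add_cancel, HahnSeries.coeff_zero] at hcoeff
  rw [HahnSeries.coeff_eq_zero_of_lt_order (show y.order - 1 < y.order by omega), mul_zero,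
    zero_sub, neg_eq_zero] at hcoeff
  exact HahnSeries.coeff_order_eq_zero.not.mpr hne hcoeff

theorem inU_mul_inU (a b : ℕ → A) :
    inU a * inU b = HahnSeries.C (HahnSeries.ofPowerSeries ℤ A
      (PowerSeries.mk a * PowerSeries.mk b)) := by
  rw [map_mul, map_mul]
  rfl

/-- If `a, b, c` stand for `L(u), L(u + h), L(v)` and `x` for `u - v`, then the quantum determinant
commutes with `c` up to the factor `x (x + 2 h)`. -/
theorem smul_qdet_commutator_eq_zero {R T : Type*} [CommRing R] [Ring T] [Algebra R T] (x h : R)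
    (a b c : Fin 2 → Fin 2 → T)
    (hac : ∀ i j k l, x • (a i j * c k l - c k l * a i j) = h • (c k j * a i l - a k j * c i l))
    (hbc : ∀ i j k l,
      (x + h) • (b i j * c k l - c k l * b i j) = h • (c k j * b i l - b k j * c i l))
    (hab : ∀ i j k l, a i j * b k l - b k l * a i j = a k j * b i l - b k j * a i l)
    (k l : Fin 2) :
    (x * (x + 2 * h)) • ((a 0 0 * b 1 1 - a 1 0 * b 0 1) * c k l -
      c k l * (a 0 0 * b 1 1 - a 1 0 * b 0 1)) = 0 := by
  have e0 : a 0 0 * b 1 0 = a 1 0 * b 0 0 := by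
    linear_combination (norm := module) hab 0 0 1 0
  have e1 : a 0 1 * b 1 1 = a 1 1 * b 0 1 := by
    linear_combination (norm := module) hab 0 1 1 1
  have e2 : a 1 1 * b 0 0 - a 0 1 * b 1 0 = a 0 0 * b 1 1 - a 1 0 * b 0 1 := by
    linear_combination (norm := module) - hab 0 1 1 0 - hab 0 0 1 1
  have hk : k = 0 ∨ k = 1 := by fin_cases k <;> simp
  have hl : l = 0 ∨ l = 1 := by fin_cases l <;> simp
  rcases hk with rfl | rfl
  · have main : (x * (x + 2 * h)) • ((a 0 0 * b 1 1 - a 1 0 * b 0 1) * c 0 l) =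
      (x + h) • ((x • (c 0 l * a 0 0) + h • (c 0 0 * a 0 l)) * b 1 1) +
      h • ((x • (c 0 1 * a 0 0) + h • (c 0 0 * a 0 1)) * b 1 l) -
      (x + h) • ((x • (c 0 l * a 1 0) + h • (c 0 0 * a 1 l)) * b 0 1) -
      h • ((x • (c 0 1 * a 1 0) + h • (c 0 0 * a 1 1)) * b 0 l) := by
      linear_combination (norm := skip) (x + h) • (a 0 0 * hbc 1 1 0 l) -
        x • (a 1 0 * hbc 0 1 0 l) - h • (a 0 0 * hbc 0 1 1 l) +
        (x + h) • (hac 0 0 0 l * b 1 1) + h • (hac 0 0 0 1 * b 1 l) -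
        (x + h) • (hac 1 0 0 l * b 0 1) - h • (hac 1 0 0 1 * b 0 l)
      simp only [mul_add, add_mul, mul_sub, sub_mul, smul_mul_assoc, mul_smul_comm, mul_assoc]
      module
    rcases hl with rfl | rfl
    · linear_combination (norm := skip) main + (h * x) • (c 0 1 * e0) - (h * h) • (c 0 0 * e2)
      simp only [mul_add, add_mul, mul_sub, sub_mul, smul_mul_assoc, mul_assoc]
      module
    · linear_combination (norm := skip) main + ((x + 2 * h) * h) • (c 0 0 * e1)
      simp only [mul_add, add_mul, mul_sub, sub_mul, smul_mul_assoc, mul_assoc]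
      module
  · have main : (x * (x + 2 * h)) • ((a 0 0 * b 1 1 - a 1 0 * b 0 1) * c 1 l) =
      (x + h) • ((x • (c 1 l * a 0 0) + h • (c 1 0 * a 0 l)) * b 1 1) +
      h • ((x • (c 1 1 * a 0 0) + h • (c 1 0 * a 0 1)) * b 1 l) -
      (x + h) • ((x • (c 1 l * a 1 0) + h • (c 1 0 * a 1 l)) * b 0 1) -
      h • ((x • (c 1 1 * a 1 0) + h • (c 1 0 * a 1 1)) * b 0 l) := by
      linear_combination (norm := skip) x • (a 0 0 * hbc 1 1 1 l) +
        h • (a 1 0 * hbc 1 1 0 l) - (x + h) • (a 1 0 * hbc 0 1 1 l) +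
        (x + h) • (hac 0 0 1 l * b 1 1) + h • (hac 0 0 1 1 * b 1 l) -
        (x + h) • (hac 1 0 1 l * b 0 1) - h • (hac 1 0 1 1 * b 0 l)
      simp only [mul_add, add_mul, mul_sub, sub_mul, smul_mul_assoc, mul_smul_comm, mul_assoc]
      module
    rcases hl with rfl | rfl
    · linear_combination (norm := skip) main + (h * x) • (c 1 1 * e0) - (h * h) • (c 1 0 * e2)
      simp only [mul_add, add_mul, mul_sub, sub_mul, smul_mul_assoc, mul_assoc]
      module
    · linear_combination (norm := skip) main + ((x + 2 * h) * h) • (c 1 0 * e1)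
      simp only [mul_add, add_mul, mul_sub, sub_mul, smul_mul_assoc, mul_assoc]
      module

theorem mul_qdet_commutator_eq_zero {T : Type*} [Ring T] {x h : T}
    (hx : x ∈ Subring.center T) (hh : h ∈ Subring.center T) (a b c : Fin 2 → Fin 2 → T)
    (hac : ∀ i j k l, x * (a i j * c k l - c k l * a i j) = h * (c k j * a i l - a k j * c i l))
    (hbc : ∀ i j k l,
      (x + h) * (b i j * c k l - c k l * b i j) = h * (c k j * b i l - b k j * c i l))
    (hab : ∀ i j k l, a i j * b k l - b k l * a i j = a k j * b i l - b k j * a i l)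
    (k l : Fin 2) :
    x * ((x + h + h) * ((a 0 0 * b 1 1 - a 1 0 * b 0 1) * c k l -
      c k l * (a 0 0 * b 1 1 - a 1 0 * b 0 1))) = 0 := by
  have key := smul_qdet_commutator_eq_zero (⟨x, hx⟩ : Subring.center T) ⟨h, hh⟩ a b c hac hbc hab k l
  rw [two_mul, ← add_assoc, mul_smul] at key
  exact key

/-- Centrality of the quantum determinant (2×2 instance of Theorem 4.5):
`qdet L(u)` commutes with all generating series `l_{ij}(v)`. -/
theorem stmt19 (h : A) (hcen : ∀ a : A, a * h = h * a)
    (lgen : Fin 2 → Fin 2 → ℕ → A) (hRTT : RTT h lgen) :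
    ∀ i j : Fin 2,
      qdetU h lgen * inV (lcoef h lgen i j) = inV (lcoef h lgen i j) * qdetU h lgen := by
  intro i j
  have hrel (i j k l : Fin 2) : CoeffRel 0 h (lcoef h lgen i j) (lcoef h lgen k l)
      (lcoef h lgen k j) (lcoef h lgen i l) (lcoef h lgen k j) (lcoef h lgen i l) := by
    rw [coeffRel_iff]
    simpa [sc] using hRTT i j k l
  have hh : h ∈ Subring.center A := Subring.mem_center_iff.mpr hcen
  have hx : Uv A - Vv A ∈ Subring.center (TT A) := sub_mem
    (single_mem_center 0 (single_mem_center (-1) (one_mem _))) (single_mem_center (-1) (one_mem _))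
  have key := mul_qdet_commutator_eq_zero hx (single_mem_center 0 (single_mem_center 0 hh))
    (fun i j => inU (lcoef h lgen i j)) (fun i j => inU (shiftSeq h (lcoef h lgen i j)))
    (fun i j => inV (lcoef h lgen i j)) hRTT
    (fun i j k l => by
      have H := (coeffRel_iff _ _ _ _ _ _ _ _).mp ((hrel i j k l).shift hcen)
      rwa [add_sub_right_comm] at H)
    (fun i j k l => by
      simp only [inU_mul_inU, ← map_sub]
      rw [(hrel i j k l).fusion hcen])
    i j
  have hy := eq_zero_of_sub_Vv_mul (HahnSeries.single (-1 : ℤ) 1) _ key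
  rw [← add_sub_right_comm, ← add_sub_right_comm, Uv, ← HahnSeries.single_add,
    ← HahnSeries.single_add] at hy
  exact sub_eq_zero.mp (eq_zero_of_sub_Vv_mul _ _ hy)
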